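/- arXiv:math/0107004 — 8 statements merged into one kernel-verified Lean document; each statement's English description precedes it below -/
import Mathlib

section
/- For all m, n ≥ 0, the ℤ-algebra homomorphism Num_m ⊗_ℤ Num_n → Num_{m+n} determined on simple tensors by f ⊗ g ↦ ((a,b) ↦ f(a)·g(b)), for a ∈ ℤ^m and b ∈ ℤ^n, is an isomorphism of rings. -/
open scoped TensorProduct

/-- A function `f : ℤ^m → ℤ` is numerical if it is given by a polynomial with
rational coefficients. -/
def IsNumerical {m : ℕ} (f : (Fin m → ℤ) → ℤ) : Prop :=
  ∃ P : MvPolynomial (Fin m) ℚ,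
    ∀ a : Fin m → ℤ, (f a : ℚ) = MvPolynomial.eval (fun i => (a i : ℚ)) P

/-- `Num_m`, the ring of numerical functions `ℤ^m → ℤ`, as a subring of the ring of all
functions `ℤ^m → ℤ` with pointwise operations. -/
def numRing (m : ℕ) : Subring ((Fin m → ℤ) → ℤ) where
  carrier := {f | IsNumerical f}
  zero_mem' := ⟨0, fun a => by simp⟩
  one_mem' := ⟨1, fun a => by simp⟩
  add_mem' := by
    rintro f g ⟨P, hP⟩ ⟨Q, hQ⟩
    exact ⟨P + Q, fun a => by
      simp only [Pi.add_apply, map_add, ← hP a, ← hQ a]; push_cast; ring⟩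
  neg_mem' := by
    rintro f ⟨P, hP⟩
    exact ⟨-P, fun a => by
      simp only [Pi.neg_apply, map_neg, ← hP a]; push_cast; ring⟩
  mul_mem' := by
    rintro f g ⟨P, hP⟩ ⟨Q, hQ⟩
    exact ⟨P * Q, fun a => by
      simp only [Pi.mul_apply, map_mul, ← hP a, ← hQ a]; push_cast; ring⟩

open MvPolynomial in
theorem IsNumerical.comp_reindex {m n : ℕ} {f : (Fin m → ℤ) → ℤ} (hf : IsNumerical f)
    (σ : Fin m → Fin n) : IsNumerical fun a => f (a ∘ σ) := by
  obtain ⟨P, hP⟩ := hf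
  exact ⟨rename σ P, fun a => by rw [hP, eval_rename]; rfl⟩

/-- Reindexing of variables, as a homomorphism between rings of numerical functions. -/
def numRing.reindex {m n : ℕ} (σ : Fin m → Fin n) : numRing m →ₐ[ℤ] numRing n :=
  RingHom.toIntAlgHom
    { toFun := fun f => ⟨fun a => f.1 (a ∘ σ), IsNumerical.comp_reindex f.2 σ⟩
      map_one' := rfl
      map_mul' := fun _ _ => rfl
      map_zero' := rfl
      map_add' := fun _ _ => rfl }

@[simp]
theorem numRing.reindex_apply {m n : ℕ} (σ : Fin m → Fin n) (f : numRing m) (a : Fin n → ℤ) :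
    (numRing.reindex σ f).1 a = f.1 (a ∘ σ) := rfl

theorem Int.succ_mul_choose_succ (x : ℤ) (k : ℕ) :
    ((k : ℤ) + 1) * Ring.choose x (k + 1) = (x - k) * Ring.choose x k := by
  have h₁ := Ring.descPochhammer_eq_factorial_smul_choose x (k + 1)
  have h₂ := Ring.descPochhammer_eq_factorial_smul_choose x k
  have h₃ : (descPochhammer ℤ (k + 1)).smeval x = (descPochhammer ℤ k).smeval x * (x - k) := by
    simp only [← Polynomial.eval_eq_smeval, descPochhammer_succ_right]
    simp
  rw [h₁, h₂, Nat.factorial_succ] at h₃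
  have hk : (k.factorial : ℤ) ≠ 0 := by exact_mod_cast k.factorial_ne_zero
  apply mul_left_cancel₀ hk
  simp only [nsmul_eq_mul] at h₃
  push_cast at h₃
  linear_combination h₃

open MvPolynomial in
theorem isNumerical_choose {m : ℕ} (i : Fin m) (k : ℕ) :
    IsNumerical fun a : Fin m → ℤ => Ring.choose (a i) k := by
  induction k with
  | zero => exact ⟨1, fun a => by simp⟩
  | succ k ih =>
    obtain ⟨P, hP⟩ := ih
    refine ⟨C ((k : ℚ) + 1)⁻¹ * ((X i - C (k : ℚ)) * P), fun a => ?_⟩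
    have h := congrArg (Int.cast (R := ℚ)) (Int.succ_mul_choose_succ (a i) k)
    push_cast at h
    have hk : (k : ℚ) + 1 ≠ 0 := by positivity
    simp only [map_mul, map_sub, eval_C, eval_X, ← hP a]
    rw [← h, inv_mul_cancel_left₀ hk]

/-- The numerical function `a ↦ ∏ i, (a i choose α i)`. -/
def binom {m : ℕ} (α : Fin m → ℕ) : numRing m :=
  ⟨∏ i, fun a => Ring.choose (a i) (α i),
    Subring.prod_mem _ fun i _ => isNumerical_choose i (α i)⟩

theorem binom_apply {m : ℕ} (α : Fin m → ℕ) (a : Fin m → ℤ) :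
    (binom α).1 a = ∏ i, Ring.choose (a i) (α i) := by
  simp [binom]

theorem binom_natCast {m : ℕ} (α β : Fin m → ℕ) :
    (binom α).1 (fun i => (β i : ℤ)) = ((∏ i, (β i).choose (α i) : ℕ) : ℤ) := by
  simp [binom_apply, Ring.choose_natCast]

/-- The coefficients of a rational combination of products of binomial coefficients lie in every
additive subgroup of `ℚ` which contains its values at tuples of natural numbers. -/
theorem coeff_mem_of_binom_sum_mem {m : ℕ} (S : AddSubgroup ℚ) (c : (Fin m → ℕ) →₀ ℚ)
    (h : ∀ β : Fin m → ℕ, (c.sum fun α q => q * (binom α).1 fun i => (β i : ℤ)) ∈ S)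
    (β : Fin m → ℕ) : c β ∈ S := by
  induction β using WellFoundedLT.induction with
  | ind β ih =>
    have hβ := h β
    rw [Finsupp.sum_of_support_subset c (Finset.subset_insert β c.support) _ (by simp),
      ← Finset.add_sum_erase _ _ (Finset.mem_insert_self β c.support)] at hβ
    have hdiag : c β * ((binom β).1 fun i => (β i : ℤ)) = c β := by simp [binom_natCast]
    rw [hdiag] at hβ
    refine (S.add_mem_cancel_right (S.sum_mem fun α hα => ?_)).mp hβ
    rw [binom_natCast]
    by_cases hle : α ≤ β
    · have := S.nsmul_mem (ih α (lt_of_le_of_ne hle (Finset.ne_of_mem_erase hα)))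
        (∏ i, (β i).choose (α i))
      rw [nsmul_eq_mul, mul_comm] at this
      exact_mod_cast this
    · obtain ⟨i, hi⟩ := not_forall.mp hle
      rw [Finset.prod_eq_zero (Finset.mem_univ i) (Nat.choose_eq_zero_of_lt (not_le.mp hi))]
      simp

theorem mul_binom {m : ℕ} (α : Fin m → ℕ) (i : Fin m) (a : Fin m → ℤ) :
    a i * (binom α).1 a =
      ((α i : ℤ) + 1) * (binom (Function.update α i (α i + 1))).1 a + α i * (binom α).1 a := by
  have h : (binom (Function.update α i (α i + 1))).1 a =
      Ring.choose (a i) (α i + 1) * ∏ j ∈ Finset.univ.erase i, Ring.choose (a j) (α j) := by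
    rw [binom_apply, ← Finset.mul_prod_erase _ _ (Finset.mem_univ i), Function.update_self]
    congr 1
    refine Finset.prod_congr rfl fun j hj => ?_
    rw [Function.update_of_ne (Finset.ne_of_mem_erase hj)]
  rw [h, binom_apply, ← Finset.mul_prod_erase _ _ (Finset.mem_univ i)]
  linear_combination (-∏ j ∈ Finset.univ.erase i, Ring.choose (a j) (α j)) *
    Int.succ_mul_choose_succ (a i) (α i)

open MvPolynomial in
theorem eval_mem_span_binom {m : ℕ} (P : MvPolynomial (Fin m) ℚ) :
    (fun a : Fin m → ℤ => eval (fun i => (a i : ℚ)) P) ∈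
      Submodule.span ℚ (Set.range fun (α : Fin m → ℕ) (a : Fin m → ℤ) => ((binom α).1 a : ℚ)) := by
  have hmem (α : Fin m → ℕ) := Submodule.subset_span (R := ℚ)
    (Set.mem_range_self (f := fun (α : Fin m → ℕ) (a : Fin m → ℤ) => ((binom α).1 a : ℚ)) α)
  induction P using MvPolynomial.induction_on with
  | C q =>
    convert Submodule.smul_mem _ q (hmem 0) using 1
    ext a
    simp [binom_apply]
  | add P Q hP hQ =>
    simp only [map_add]
    exact Submodule.add_mem _ hP hQ
  | mul_X P i hP =>
    simp only [map_mul, eval_X]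
    change (fun a => (fun a : Fin m → ℤ => eval (fun i => (a i : ℚ)) P) a * (a i : ℚ)) ∈ _
    generalize (fun a : Fin m → ℤ => eval (fun i => (a i : ℚ)) P) = F at hP
    induction hP using Submodule.span_induction with
    | mem f hf =>
      obtain ⟨α, rfl⟩ := hf
      convert Submodule.add_mem _
        (Submodule.smul_mem _ ((α i : ℚ) + 1) (hmem (Function.update α i (α i + 1))))
        (Submodule.smul_mem _ (α i : ℚ) (hmem α)) using 1
      ext a
      have := congrArg (Int.cast (R := ℚ)) (mul_binom α i a)
      push_cast at this
      simpa [mul_comm] using this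
    | zero =>
      simp only [Pi.zero_apply, zero_mul]
      exact Submodule.zero_mem _
    | add f g _ _ hf hg =>
      convert Submodule.add_mem _ hf hg using 1
      ext a
      simp [add_mul]
    | smul q f _ hf =>
      convert Submodule.smul_mem _ q hf using 1
      ext a
      simp [mul_assoc]

theorem linearIndependent_binom (m : ℕ) :
    LinearIndependent ℤ (binom : (Fin m → ℕ) → numRing m) := by
  rw [linearIndependent_iff]
  intro c hc
  ext β
  have := coeff_mem_of_binom_sum_mem ⊥ (c.mapRange (Int.cast (R := ℚ)) Int.cast_zero)
    (fun γ => ?_) β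
  · simpa using this
  · have h := congrArg (fun f : numRing m => ((f.1 fun i => (γ i : ℤ) : ℤ) : ℚ)) hc
    rw [Finsupp.sum_mapRange_index (by simp), AddSubgroup.mem_bot]
    simpa [Finsupp.linearCombination_apply, Finsupp.sum, Finset.sum_apply] using h

theorem span_binom (m : ℕ) :
    Submodule.span ℤ (Set.range (binom : (Fin m → ℕ) → numRing m)) = ⊤ := by
  rw [eq_top_iff]
  rintro ⟨f, P, hP⟩ -
  obtain ⟨c, hc⟩ := Finsupp.mem_span_range_iff_exists_finsupp.mp (eval_mem_span_binom P)
  have hval (a : Fin m → ℤ) : (c.sum fun α q => q * ((binom α).1 a : ℚ)) = f a := by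
    rw [hP, ← congrFun hc a]
    simp [Finsupp.sum, Finset.sum_apply]
  have h_int (α : Fin m → ℕ) : ∃ z : ℤ, (z : ℚ) = c α :=
    coeff_mem_of_binom_sum_mem (Int.castAddHom ℚ).range c
      (fun β => ⟨f fun i => (β i : ℤ), (hval _).symm⟩) α
  choose z hz using h_int
  have hf : (⟨f, P, hP⟩ : numRing m) = ∑ α ∈ c.support, z α • binom α := by
    ext a
    have := hval a
    simp only [Finsupp.sum, ← hz] at this
    have h : (∑ α ∈ c.support, z α * (binom α).1 a) = f a := by exact_mod_cast this
    simpa [Finset.sum_apply] using h.symm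
  rw [hf]
  exact Submodule.sum_mem _ fun α _ =>
    Submodule.smul_mem _ _ (Submodule.subset_span (Set.mem_range_self α))

/-- The products of binomial coefficients form a basis of the ring of numerical functions. -/
noncomputable def binomBasis (m : ℕ) : Module.Basis (Fin m → ℕ) ℤ (numRing m) :=
  Module.Basis.mk (linearIndependent_binom m) (span_binom m).ge

theorem reindex_binom_mul_reindex_binom {m n : ℕ} (α : Fin m → ℕ) (β : Fin n → ℕ) :
    numRing.reindex (Fin.castAdd n) (binom α) * numRing.reindex (Fin.natAdd m) (binom β) =
      binom (Fin.append α β) := by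
  ext a
  change (numRing.reindex (Fin.castAdd n) (binom α)).1 a *
    (numRing.reindex (Fin.natAdd m) (binom β)).1 a = (binom (Fin.append α β)).1 a
  simp [binom_apply, Fin.prod_univ_add]

/-- The ℤ-algebra homomorphism `Num_m ⊗_ℤ Num_n → Num_{m+n}` determined on simple tensors
by `f ⊗ g ↦ ((a,b) ↦ f(a)·g(b))` is an isomorphism of rings. -/
theorem numRing_tensorProduct_equiv (m n : ℕ) :
    ∃ e : (numRing m ⊗[ℤ] numRing n) ≃+* numRing (m + n),
      ∀ (f : numRing m) (g : numRing n) (a : Fin (m + n) → ℤ),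
        (e (f ⊗ₜ[ℤ] g) : (Fin (m + n) → ℤ) → ℤ) a =
          (f : (Fin m → ℤ) → ℤ) (fun i => a (Fin.castAdd n i)) *
          (g : (Fin n → ℤ) → ℤ) (fun j => a (Fin.natAdd m j)) := by
  let φ : numRing m ⊗[ℤ] numRing n →ₐ[ℤ] numRing (m + n) :=
    Algebra.TensorProduct.productMap (numRing.reindex (Fin.castAdd n))
      (numRing.reindex (Fin.natAdd m))
  let ψ : numRing m ⊗[ℤ] numRing n ≃ₗ[ℤ] numRing (m + n) :=
    ((binomBasis m).tensorProduct (binomBasis n)).equiv (binomBasis (m + n))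
      (Fin.appendEquiv m n)
  have h : φ.toLinearMap = ψ.toLinearMap := by
    refine ((binomBasis m).tensorProduct (binomBasis n)).ext fun ⟨α, β⟩ => ?_
    simp only [ψ, LinearEquiv.coe_coe, Module.Basis.equiv_apply]
    simpa [φ, binomBasis, Module.Basis.tensorProduct_apply, Fin.appendEquiv] using
      reindex_binom_mul_reindex_binom α β
  have hφ : Function.Bijective φ := by
    have : (φ : _ → _) = ψ := funext fun x => LinearMap.congr_fun h x
    exact this ▸ ψ.bijective
  refine ⟨RingEquiv.ofBijective φ hφ, fun f g a => ?_⟩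
  change (φ (f ⊗ₜ[ℤ] g)).1 a = _
  rw [Algebra.TensorProduct.productMap_apply_tmul]
  rfl
end

section
/- For every m ≥ 0, the evaluation map is a bijection from ℤ^m onto the set of ring homomorphisms Num_m → ℤ: for every ring homomorphism χ : Num_m → ℤ there is a unique point a ∈ ℤ^m such that χ(f) = f(a) for all f ∈ Num_m. -/
/-- Every rational polynomial becomes integral after multiplying by a nonzero integer. -/
theorem MvPolynomial.exists_map_intCast_eq_C_mul {σ : Type*} (P : MvPolynomial σ ℚ) :
    ∃ N : ℤ, N ≠ 0 ∧ ∃ Q : MvPolynomial σ ℤ,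
      MvPolynomial.map (Int.castRingHom ℚ) Q = MvPolynomial.C (N : ℚ) * P := by
  induction P using MvPolynomial.induction_on with
  | C q =>
    refine ⟨q.den, by exact_mod_cast q.den_nz, MvPolynomial.C q.num, ?_⟩
    rw [MvPolynomial.map_C, ← MvPolynomial.C_mul]
    congr 1
    simp [mul_comm, Rat.mul_den_eq_num]
  | add P₁ P₂ h₁ h₂ =>
    obtain ⟨N₁, hN₁, Q₁, hQ₁⟩ := h₁
    obtain ⟨N₂, hN₂, Q₂, hQ₂⟩ := h₂
    refine ⟨N₁ * N₂, mul_ne_zero hN₁ hN₂,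
      MvPolynomial.C N₂ * Q₁ + MvPolynomial.C N₁ * Q₂, ?_⟩
    simp only [map_add, map_mul, MvPolynomial.map_C, hQ₁, hQ₂]
    simp only [Int.coe_castRingHom, Int.cast_mul, MvPolynomial.C_mul]
    ring
  | mul_X P i h =>
    obtain ⟨N, hN, Q, hQ⟩ := h
    exact ⟨N, hN, Q * MvPolynomial.X i, by rw [map_mul, hQ, MvPolynomial.map_X, mul_assoc]⟩

/-- The `i`-th coordinate as a numerical function. -/
def numRing.coord {m : ℕ} (i : Fin m) : numRing m :=
  ⟨fun a => a i, MvPolynomial.X i, fun a => by simp⟩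

/-- A polynomial in the coordinate functions evaluates pointwise. -/
theorem numRing.aeval_coord_apply {m : ℕ} (Q : MvPolynomial (Fin m) ℤ) (a : Fin m → ℤ) :
    (MvPolynomial.aeval (numRing.coord (m := m)) Q : (Fin m → ℤ) → ℤ) a =
      MvPolynomial.eval a Q := by
  induction Q using MvPolynomial.induction_on with
  | C n => simp
  | add P Q hP hQ => simp [hP, hQ]
  | mul_X P i h => simp [h, numRing.coord]

/-- Evaluation is a bijection from `ℤ^m` to the set of ring homomorphisms `Num_m → ℤ`:
every ring homomorphism `χ : Num_m → ℤ` is evaluation at a unique point `a ∈ ℤ^m`. -/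
theorem numRing_ringHom_eq_eval (m : ℕ) (χ : numRing m →+* ℤ) :
    ∃! a : Fin m → ℤ, ∀ f : numRing m, χ f = (f : (Fin m → ℤ) → ℤ) a := by
  refine ⟨fun i => χ (numRing.coord i), fun f => ?_,
    fun b hb => funext fun i => (hb (numRing.coord i)).symm⟩
  obtain ⟨P, hP⟩ := f.2
  obtain ⟨N, hN, Q, hQ⟩ := P.exists_map_intCast_eq_C_mul
  have eval_Q : ∀ a, MvPolynomial.eval a Q = N * (f : (Fin m → ℤ) → ℤ) a := fun a => by
    have h := congrArg (MvPolynomial.eval fun i => (a i : ℚ)) hQ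
    rw [map_mul, MvPolynomial.eval_C, ← hP a, MvPolynomial.eval_map] at h
    have h' := MvPolynomial.eval₂_comp_left (Int.castRingHom ℚ) (RingHom.id ℤ) a Q
    rw [RingHom.comp_id] at h'
    have cast_eval : ((MvPolynomial.eval a Q : ℤ) : ℚ) = N * ((f : (Fin m → ℤ) → ℤ) a : ℚ) :=
      h'.trans h
    exact_mod_cast cast_eval
  have aeval_Q : MvPolynomial.aeval numRing.coord Q = (N : numRing m) * f := by
    ext a
    rw [numRing.aeval_coord_apply, eval_Q]
    simp
  apply mul_left_cancel₀ hN
  rw [← eval_Q]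
  have h := congrArg χ aeval_Q
  rw [map_mul, map_intCast, Int.cast_id] at h
  rw [← h]
  have h' := MvPolynomial.map_aeval (numRing.coord (m := m)) χ Q
  rw [h', MvPolynomial.eval, MvPolynomial.coe_eval₂Hom, MvPolynomial.coe_eval₂Hom]
  congr 1
  exact RingHom.ext_int _ _
end

section
/- Let R be a subring of ℚ and let P be a polynomial in n variables with rational coefficients such that P(a) ∈ ℤ for all a ∈ ℤ^n. Then P(r) ∈ R for all r ∈ R^n. -/
/-- A subring of `ℚ` contains the inverse of the denominator of each of its elements. -/
theorem Subring.inv_den_mem {R : Subring ℚ} {r : ℚ} (hr : r ∈ R) : (r.den : ℚ)⁻¹ ∈ R := by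
  obtain ⟨u, v, huv⟩ := (Rat.isCoprime_num_den r : IsCoprime r.num (r.den : ℤ))
  have hq : (u : ℚ) * r.num + v * r.den = 1 := by exact_mod_cast huv
  have h : (r.den : ℚ)⁻¹ = u * r + v :=
    inv_eq_of_mul_eq_one_left (by rw [← hq, add_mul, mul_assoc, Rat.mul_den_eq_num])
  rw [h]
  exact R.add_mem (R.mul_mem (intCast_mem R u) hr) (intCast_mem R v)

/-- The integers surject onto the quotient of a subring of `ℚ` by a prime number. -/
theorem Subring.exists_int_add_prime_mul (R : Subring ℚ) {p : ℕ} (hp : p.Prime) (r : R) :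
    ∃ (a : ℤ) (s : R), r = a + p * s := by
  have hp0 : (p : ℚ) ≠ 0 := by exact_mod_cast hp.ne_zero
  have hinv := Subring.inv_den_mem r.2
  by_cases hdvd : p ∣ (r : ℚ).den
  · obtain ⟨k, hk⟩ := hdvd
    have hk' : ((r : ℚ).den : ℚ) = p * k := by exact_mod_cast hk
    have hpinv : (p : ℚ)⁻¹ ∈ R := by
      have h : (p : ℚ)⁻¹ = k * ((r : ℚ).den : ℚ)⁻¹ := by
        have hk0 : (k : ℚ) ≠ 0 := by
          intro h
          simp [h] at hk'
        rw [hk']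
        field_simp
      rw [h]
      exact R.mul_mem (natCast_mem R k) hinv
    refine ⟨0, ⟨(p : ℚ)⁻¹, hpinv⟩ * r, Subtype.ext ?_⟩
    push_cast
    field_simp
    simp
  · obtain ⟨e, f, hef⟩ := Nat.isCoprime_iff_coprime.mpr
      ((Nat.Prime.coprime_iff_not_dvd hp).mpr hdvd).symm
    have hq : (e : ℚ) * (r : ℚ).den + f * p = 1 := by exact_mod_cast hef
    refine ⟨(r : ℚ).num * e, f * r, Subtype.ext ?_⟩
    push_cast
    rw [← Rat.mul_den_eq_num (r : ℚ)]
    linear_combination (-(r : ℚ)) * hq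

/-- The integers surject onto the quotient of a subring of `ℚ` by a nonzero natural number. -/
theorem Subring.exists_int_add_natCast_mul (R : Subring ℚ) {D : ℕ} (hD : D ≠ 0) (r : R) :
    ∃ (a : ℤ) (s : R), r = a + D * s := by
  induction D using induction_on_primes generalizing r with
  | zero => exact absurd rfl hD
  | one => exact ⟨0, r, by simp⟩
  | prime_mul p D hp ih =>
    obtain ⟨a, s, rfl⟩ := R.exists_int_add_prime_mul hp r
    obtain ⟨b, t, rfl⟩ := ih (right_ne_zero_of_mul hD) s
    exact ⟨a + p * b, t, by push_cast; ring⟩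

/-- Denominators of a rational multivariate polynomial can be cleared. -/
theorem MvPolynomial.exists_map_intCast_eq_natCast_mul {σ : Type*} (P : MvPolynomial σ ℚ) :
    ∃ D : ℕ, D ≠ 0 ∧ ∃ Q : MvPolynomial σ ℤ, Q.map (Int.castRingHom ℚ) = D * P := by
  induction P using MvPolynomial.induction_on with
  | C a =>
    refine ⟨a.den, a.den_ne_zero, C a.num, ?_⟩
    rw [map_C, ← map_natCast (C : ℚ →+* MvPolynomial σ ℚ), ← C_mul, Rat.den_mul_eq_num]
    simp
  | add p q hp hq =>
    obtain ⟨D, hD, P, hP⟩ := hp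
    obtain ⟨E, hE, Q, hQ⟩ := hq
    refine ⟨D * E, mul_ne_zero hD hE, E * P + D * Q, ?_⟩
    simp only [map_add, map_mul, map_natCast, hP, hQ]
    push_cast
    ring
  | mul_X p i hp =>
    obtain ⟨D, hD, P, hP⟩ := hp
    exact ⟨D, hD, P * X i, by rw [map_mul, hP, map_X, mul_assoc]⟩

/-- Evaluations of an integer polynomial at points congruent modulo `d` are congruent modulo
`d`. -/
theorem MvPolynomial.dvd_aeval_sub_aeval {σ A : Type*} [CommRing A] (Q : MvPolynomial σ ℤ)
    {d : A} {x y : σ → A} (h : ∀ i, d ∣ x i - y i) : d ∣ aeval x Q - aeval y Q := by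
  rw [← Ideal.mem_span_singleton, ← Ideal.Quotient.eq]
  change Ideal.Quotient.mkₐ ℤ (Ideal.span {d}) _ = Ideal.Quotient.mkₐ ℤ (Ideal.span {d}) _
  rw [comp_aeval_apply, comp_aeval_apply]
  congr 2
  funext i
  exact Ideal.Quotient.eq.mpr (Ideal.mem_span_singleton.mpr (h i))

/-- If `R` is a subring of `ℚ` and `P ∈ ℚ[X_1,…,X_n]` satisfies `P(a) ∈ ℤ` for all
`a ∈ ℤ^n`, then `P(r) ∈ R` for all `r ∈ R^n`. -/
theorem integer_valued_polynomial_maps_subring_of_rat (R : Subring ℚ) (n : ℕ)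
    (P : MvPolynomial (Fin n) ℚ)
    (hP : ∀ a : Fin n → ℤ, ∃ z : ℤ, MvPolynomial.eval (fun i => (a i : ℚ)) P = (z : ℚ))
    (r : Fin n → R) :
    MvPolynomial.eval (fun i => (r i : ℚ)) P ∈ R := by
  obtain ⟨D, hD, Q, hQ⟩ := P.exists_map_intCast_eq_natCast_mul
  choose a s has using fun i => R.exists_int_add_natCast_mul hD (r i)
  obtain ⟨z, hz⟩ := hP a
  have hD0 : (D : ℚ) ≠ 0 := by exact_mod_cast hD
  have heval (x : Fin n → R) :
      ((MvPolynomial.aeval x Q : R) : ℚ) = D * MvPolynomial.eval (fun i => (x i : ℚ)) P := by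
    have h := congrArg (MvPolynomial.eval (fun i => (x i : ℚ))) hQ
    rw [map_mul, map_natCast, MvPolynomial.eval_map] at h
    rw [← h]
    exact MvPolynomial.comp_aeval_apply x R.subtype.toIntAlgHom Q
  obtain ⟨t, ht⟩ := Q.dvd_aeval_sub_aeval (d := (D : R)) (x := r) (y := fun i => (a i : R))
    fun i => ⟨s i, by rw [has i]; ring⟩
  have ht' := congrArg (Subtype.val : R → ℚ) ht
  push_cast at ht'
  rw [heval, heval] at ht'
  push_cast at ht'
  rw [hz, ← mul_sub] at ht'
  rw [sub_eq_iff_eq_add.mp (mul_left_cancel₀ hD0 ht')]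
  exact R.add_mem t.2 (intCast_mem R z)
end

section
/- Let p be a prime. A polynomial P in n variables with coefficients in ℚ_p satisfies P(x) ∈ ℤ_p for all x ∈ ℤ_p^n if and only if P is a finite ℤ_p-linear combination of the products C(X_1,ν_1)·C(X_2,ν_2)⋯C(X_n,ν_n), ν ∈ ℕ^n, of binomial polynomials in the variables; moreover these products are ℤ_p-linearly independent, so they form a basis of the ℤ_p-module of such polynomials. -/
variable (p : ℕ) [Fact p.Prime]

/-- The binomial polynomial `C(X,k) = X(X-1)⋯(X-k+1)/k!`, with coefficients in `ℚ_p`. -/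
noncomputable def binPolyPadic (k : ℕ) : Polynomial ℚ_[p] :=
  Polynomial.C ((k.factorial : ℚ_[p]))⁻¹ * descPochhammer ℚ_[p] k

/-- The product `C(X_1,ν_1)⋯C(X_n,ν_n)` of binomial polynomials in the variables,
as a polynomial in `n` variables over `ℚ_p`. -/
noncomputable def mvBinPadic {n : ℕ} (ν : Fin n → ℕ) : MvPolynomial (Fin n) ℚ_[p] :=
  ∏ i, Polynomial.aeval (MvPolynomial.X i : MvPolynomial (Fin n) ℚ_[p]) (binPolyPadic p (ν i))

theorem eval_binPolyPadic_coe (k : ℕ) (x : ℤ_[p]) :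
    (binPolyPadic p k).eval (x : ℚ_[p]) = (Ring.choose x k : ℤ_[p]) := by
  have h := Ring.descPochhammer_eq_factorial_smul_choose x k
  rw [← Polynomial.aeval_eq_smeval, Polynomial.aeval_def, ← Polynomial.eval_map,
    descPochhammer_map] at h
  have h' := congrArg (PadicInt.Coe.ringHom (p := p)) h
  rw [← Polynomial.eval_map_apply, descPochhammer_map, map_nsmul, nsmul_eq_mul] at h'
  change (descPochhammer ℚ_[p] k).eval (x : ℚ_[p]) =
    k.factorial * ((Ring.choose x k : ℤ_[p]) : ℚ_[p]) at h'
  rw [binPolyPadic, Polynomial.eval_C_mul, h', inv_mul_cancel_left₀]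
  exact Nat.cast_ne_zero.mpr k.factorial_ne_zero

theorem eval_mvBinPadic {n : ℕ} (ν : Fin n → ℕ) (x : Fin n → ℤ_[p]) :
    MvPolynomial.eval (fun i => (x i : ℚ_[p])) (mvBinPadic p ν) =
      ((∏ i, Ring.choose (x i) (ν i) : ℤ_[p]) : ℚ_[p]) := by
  have h (i : Fin n) : MvPolynomial.eval (fun i => (x i : ℚ_[p]))
      (Polynomial.aeval (MvPolynomial.X i) (binPolyPadic p (ν i))) =
      (Ring.choose (x i) (ν i) : ℤ_[p]) := by
    rw [← eval_binPolyPadic_coe, ← MvPolynomial.coe_aeval_eq_eval, RingHom.coe_coe,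
      ← Polynomial.aeval_algHom_apply, MvPolynomial.aeval_X, Polynomial.coe_aeval_eq_eval]
  rw [mvBinPadic, map_prod, Finset.prod_congr rfl fun i _ => h i]
  exact (map_prod (PadicInt.Coe.ringHom (p := p)) (fun i => Ring.choose (x i) (ν i)) _).symm

theorem eval_natCast_mvBinPadic {n : ℕ} (ν m : Fin n → ℕ) :
    MvPolynomial.eval (fun i => (m i : ℚ_[p])) (mvBinPadic p ν) =
      ((∏ i, (m i).choose (ν i) : ℕ) : ℚ_[p]) := by
  simpa only [Ring.choose_natCast, PadicInt.coe_natCast, ← Nat.cast_prod] using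
    eval_mvBinPadic p ν (fun i => (m i : ℤ_[p]))

/-- The coefficients of a combination of binomial products lie in every additive subgroup that
contains its values at the points of `ℕ^n`. -/
theorem coeff_mem_of_eval_natCast_mem {n : ℕ} (S : AddSubgroup ℚ_[p])
    (c : (Fin n → ℕ) →₀ ℚ_[p])
    (h : ∀ m : Fin n → ℕ, MvPolynomial.eval (fun i => (m i : ℚ_[p]))
      (c.sum fun ν q => MvPolynomial.C q * mvBinPadic p ν) ∈ S) (ν : Fin n → ℕ) : c ν ∈ S := by
  induction ν using WellFoundedLT.induction with
  | ind ν ih =>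
    by_cases hν : ν ∈ c.support
    · have hs := h ν
      simp only [Finsupp.sum, map_sum, map_mul, MvPolynomial.eval_C,
        eval_natCast_mvBinPadic] at hs
      rw [← Finset.add_sum_erase _ _ hν] at hs
      simp only [Nat.choose_self, Finset.prod_const_one, Nat.cast_one, mul_one] at hs
      refine (S.add_mem_cancel_right (S.sum_mem fun μ hμ => ?_)).mp hs
      by_cases hle : μ ≤ ν
      · rw [mul_comm, ← nsmul_eq_mul]
        exact S.nsmul_mem (ih μ (lt_of_le_of_ne hle (Finset.ne_of_mem_erase hμ))) _
      · obtain ⟨i, hi⟩ := not_forall.mp hle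
        rw [Finset.prod_eq_zero (Finset.mem_univ i) (Nat.choose_eq_zero_of_lt (not_le.mp hi))]
        simp
    · rw [Finsupp.notMem_support_iff.mp hν]
      exact S.zero_mem

theorem binPolyPadic_mul_X (k : ℕ) :
    binPolyPadic p k * Polynomial.X =
      ((k + 1 : ℕ) : ℚ_[p]) • binPolyPadic p (k + 1) + (k : ℚ_[p]) • binPolyPadic p k := by
  have hk : ((k + 1 : ℕ) : ℚ_[p]) * (((k + 1).factorial : ℕ) : ℚ_[p])⁻¹ =
      ((k.factorial : ℕ) : ℚ_[p])⁻¹ := by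
    rw [Nat.factorial_succ, Nat.cast_mul, mul_inv, mul_inv_cancel_left₀]
    exact Nat.cast_ne_zero.mpr k.succ_ne_zero
  simp only [binPolyPadic, Polynomial.smul_eq_C_mul, ← mul_assoc, ← Polynomial.C_mul, hk]
  rw [descPochhammer_succ_right, Polynomial.C_mul, Polynomial.C_eq_natCast k]
  ring

theorem mvBinPadic_mul_X {n : ℕ} (ν : Fin n → ℕ) (i : Fin n) :
    mvBinPadic p ν * MvPolynomial.X i =
      ((ν i + 1 : ℕ) : ℚ_[p]) • mvBinPadic p (Function.update ν i (ν i + 1)) +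
        (ν i : ℚ_[p]) • mvBinPadic p ν := by
  have hX := congrArg (Polynomial.aeval (MvPolynomial.X i : MvPolynomial (Fin n) ℚ_[p]))
    (binPolyPadic_mul_X p (ν i))
  simp only [map_mul, map_add, map_smul, Polynomial.aeval_X] at hX
  have hprod : ∏ j ∈ Finset.univ.erase i, Polynomial.aeval
      (MvPolynomial.X j : MvPolynomial (Fin n) ℚ_[p])
        (binPolyPadic p (Function.update ν i (ν i + 1) j)) =
      ∏ j ∈ Finset.univ.erase i, Polynomial.aeval
        (MvPolynomial.X j : MvPolynomial (Fin n) ℚ_[p]) (binPolyPadic p (ν j)) :=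
    Finset.prod_congr rfl fun j hj => by
      rw [Function.update_of_ne (Finset.ne_of_mem_erase hj)]
  simp only [mvBinPadic]
  rw [← Finset.mul_prod_erase _ _ (Finset.mem_univ i), mul_right_comm, hX,
    ← Finset.mul_prod_erase Finset.univ (fun j => Polynomial.aeval _
      (binPolyPadic p (Function.update ν i (ν i + 1) j))) (Finset.mem_univ i),
    hprod, Function.update_self, add_mul, smul_mul_assoc, smul_mul_assoc]

theorem span_range_mvBinPadic (n : ℕ) :
    Submodule.span ℚ_[p] (Set.range (mvBinPadic p (n := n))) = ⊤ := by
  rw [Submodule.eq_top_iff']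
  intro P
  induction P using MvPolynomial.induction_on with
  | C a =>
    have h1 : mvBinPadic p (0 : Fin n → ℕ) = 1 := by simp [mvBinPadic, binPolyPadic]
    rw [← mul_one (MvPolynomial.C a), ← MvPolynomial.smul_eq_C_mul, ← h1]
    exact Submodule.smul_mem _ _ (Submodule.subset_span ⟨0, rfl⟩)
  | add P Q hP hQ => exact Submodule.add_mem _ hP hQ
  | mul_X P i hP =>
    induction hP using Submodule.span_induction with
    | mem Q hQ =>
      obtain ⟨ν, rfl⟩ := hQ
      rw [mvBinPadic_mul_X]
      exact Submodule.add_mem _ (Submodule.smul_mem _ _ (Submodule.subset_span ⟨_, rfl⟩))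
        (Submodule.smul_mem _ _ (Submodule.subset_span ⟨_, rfl⟩))
    | zero => simp
    | add Q R _ _ hQ hR =>
      rw [add_mul]
      exact Submodule.add_mem _ hQ hR
    | smul a Q _ hQ =>
      rw [smul_mul_assoc]
      exact Submodule.smul_mem _ _ hQ

/-- A polynomial `P` in `n` variables over `ℚ_p` maps `ℤ_p^n` into `ℤ_p` iff it is a
finite `ℤ_p`-linear combination of products of binomial polynomials `C(X_i,ν_i)`;
moreover these products are `ℤ_p`-linearly independent, so they form a `ℤ_p`-basis. -/
theorem padic_integer_valued_polynomial_binomial_basis (n : ℕ)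
    (P : MvPolynomial (Fin n) ℚ_[p]) :
    ((∀ x : Fin n → ℤ_[p], ∃ z : ℤ_[p],
        MvPolynomial.eval (fun i => (x i : ℚ_[p])) P = (z : ℚ_[p])) ↔
      ∃ c : (Fin n → ℕ) →₀ ℤ_[p],
        P = c.sum fun ν z => MvPolynomial.C (z : ℚ_[p]) * mvBinPadic p ν) ∧
    (∀ c₁ c₂ : (Fin n → ℕ) →₀ ℤ_[p],
      (c₁.sum fun ν z => MvPolynomial.C (z : ℚ_[p]) * mvBinPadic p ν) =
        (c₂.sum fun ν z => MvPolynomial.C (z : ℚ_[p]) * mvBinPadic p ν) → c₁ = c₂) := by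
  refine ⟨⟨fun h => ?_, ?_⟩, fun c₁ c₂ h => ?_⟩
  · obtain ⟨q, hq⟩ := Finsupp.mem_span_range_iff_exists_finsupp.mp
      (span_range_mvBinPadic p n ▸ Submodule.mem_top : P ∈ Submodule.span ℚ_[p] _)
    simp only [MvPolynomial.smul_eq_C_mul] at hq
    have hmem := coeff_mem_of_eval_natCast_mem p (PadicInt.subring p).toAddSubgroup q fun m => by
      obtain ⟨z, hz⟩ := h fun i => (m i : ℤ_[p])
      simp only [PadicInt.coe_natCast] at hz
      rw [hq, hz]
      exact z.2
    choose z hz using fun ν => (⟨⟨q ν, hmem ν⟩, rfl⟩ : ∃ z : ℤ_[p], (z : ℚ_[p]) = q ν)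
    refine ⟨Finsupp.onFinset q.support z fun ν hν => ?_, ?_⟩
    · rw [Finsupp.mem_support_iff, ← hz]
      exact fun h0 => hν (Subtype.ext h0)
    · rw [Finsupp.onFinset_sum _ fun ν => by
        rw [PadicInt.coe_zero, MvPolynomial.C_0, zero_mul]]
      simp only [hz]
      exact hq.symm
  · rintro ⟨c, rfl⟩ x
    refine ⟨c.sum fun ν z => z * ∏ i, Ring.choose (x i) (ν i), ?_⟩
    simp only [Finsupp.sum, map_sum, map_mul, MvPolynomial.eval_C, eval_mvBinPadic,
      PadicInt.coe_sum, PadicInt.coe_mul]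
  · let f : ℤ_[p] →+ ℚ_[p] := PadicInt.Coe.ringHom.toAddMonoidHom
    have hf (c : (Fin n → ℕ) →₀ ℤ_[p]) :
        ((c.mapRange f f.map_zero).sum fun ν q => MvPolynomial.C q * mvBinPadic p ν) =
          c.sum fun ν z => MvPolynomial.C (z : ℚ_[p]) * mvBinPadic p ν :=
      Finsupp.sum_mapRange_index fun ν => by simp
    have h0 := coeff_mem_of_eval_natCast_mem p ⊥
      (c₁.mapRange f f.map_zero - c₂.mapRange f f.map_zero) fun m => by
        rw [Finsupp.sum_sub_index fun ν a b => by rw [map_sub, sub_mul], hf, hf, h, sub_self,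
          map_zero]
        exact AddSubgroup.zero_mem _
    ext ν
    have hν := sub_eq_zero.mp (AddSubgroup.mem_bot.mp (h0 ν))
    rw [Finsupp.mapRange_apply, Finsupp.mapRange_apply] at hν
    exact Subtype.ext hν
end

section
/- Let p be a prime. The function c : ℤ × ℤ → ℚ, c(x,y) = ((x+y)^p − x^p − y^p)/p, takes integer values and satisfies c(x,y) = g(x) + g(y) − g(x+y) for the numerical function g : ℤ → ℤ, g(x) = −(x^p − x)/p; however, there is no polynomial f with integer coefficients such that f(x) + f(y) − f(x+y) = c(x,y) for all integers x, y. -/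
open Polynomial in
/-- An integer polynomial whose evaluation on `ℤ` is additive is a multiple of `X`. -/
theorem Polynomial.eq_C_mul_X_of_eval_add (q : ℤ[X])
    (h : ∀ x y : ℤ, q.eval (x + y) = q.eval x + q.eval y) : q = C (q.eval 1) * X := by
  refine Polynomial.funext fun n => ?_
  have key := map_zsmul (AddMonoidHom.mk' (fun x : ℤ => q.eval x) h) n 1
  simp only [AddMonoidHom.mk'_apply, smul_eq_mul, mul_one] at key
  rw [key, eval_mul, eval_C, eval_X, mul_comm]

/-- For a prime `p`, the function `c(x,y) = ((x+y)^p − x^p − y^p)/p` takes integer values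
and equals `g(x) + g(y) − g(x+y)` for the numerical function `g(x) = −(x^p − x)/p` (which
takes integer values by Fermat's little theorem); however, `c` is not the coboundary of a
polynomial with integer coefficients: there is no `f ∈ ℤ[X]` with
`f(x) + f(y) − f(x+y) = c(x,y)` for all integers `x, y`. -/
theorem polynomial_cocycle_not_integral_coboundary (p : ℕ) (hp : p.Prime) :
    (∀ x y : ℤ, ∃ z : ℤ, (((x : ℚ) + y) ^ p - (x : ℚ) ^ p - (y : ℚ) ^ p) / p = (z : ℚ)) ∧
    (∀ x : ℤ, ∃ z : ℤ, -(((x : ℚ) ^ p - (x : ℚ)) / p) = (z : ℚ)) ∧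
    (∀ x y : ℤ, (((x : ℚ) + y) ^ p - (x : ℚ) ^ p - (y : ℚ) ^ p) / p =
      -(((x : ℚ) ^ p - (x : ℚ)) / p) + -(((y : ℚ) ^ p - (y : ℚ)) / p)
        - -((((x : ℚ) + y) ^ p - ((x : ℚ) + y)) / p)) ∧
    ¬ ∃ f : Polynomial ℤ, ∀ x y : ℤ,
        ((f.eval x + f.eval y - f.eval (x + y) : ℤ) : ℚ) =
          (((x : ℚ) + y) ^ p - (x : ℚ) ^ p - (y : ℚ) ^ p) / p := by
  have hp0 : (p : ℚ) ≠ 0 := by exact_mod_cast hp.ne_zero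
  have fermat : ∀ x : ℤ, ∃ z : ℤ, -(((x : ℚ) ^ p - (x : ℚ)) / p) = (z : ℚ) := by
    intro x
    obtain ⟨k, hk⟩ := Int.prime_dvd_pow_self_sub hp x
    have hk' : (x : ℚ) ^ p - x = p * k := by exact_mod_cast hk
    exact ⟨-k, by rw [hk', mul_div_cancel_left₀ _ hp0, Int.cast_neg]⟩
  have cobound : ∀ x y : ℤ, (((x : ℚ) + y) ^ p - (x : ℚ) ^ p - (y : ℚ) ^ p) / p =
      -(((x : ℚ) ^ p - (x : ℚ)) / p) + -(((y : ℚ) ^ p - (y : ℚ)) / p)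
        - -((((x : ℚ) + y) ^ p - ((x : ℚ) + y)) / p) := fun x y => by ring
  refine ⟨fun x y => ?_, fermat, cobound, ?_⟩
  · obtain ⟨a, ha⟩ := fermat x
    obtain ⟨b, hb⟩ := fermat y
    obtain ⟨c, hc⟩ := fermat (x + y)
    rw [Int.cast_add] at hc
    exact ⟨a + b - c, by rw [cobound, ha, hb, hc]; push_cast; ring⟩
  · rintro ⟨f, hf⟩
    have hadd := Polynomial.eq_C_mul_X_of_eval_add
      (Polynomial.C (p : ℤ) * f + Polynomial.X ^ p) fun x y => by
        have h := hf x y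
        rw [eq_div_iff hp0] at h
        have h' : (f.eval x + f.eval y - f.eval (x + y)) * (p : ℤ) =
            (x + y) ^ p - x ^ p - y ^ p := by exact_mod_cast h
        simp only [Polynomial.eval_add, Polynomial.eval_mul, Polynomial.eval_C,
          Polynomial.eval_pow, Polynomial.eval_X]
        linear_combination -h'
    have hcoeff := congrArg (fun q : Polynomial ℤ => q.coeff p) hadd
    simp only [Polynomial.coeff_add, Polynomial.coeff_C_mul, Polynomial.coeff_X_pow_self,
      Polynomial.coeff_X_of_ne_one hp.ne_one, mul_zero] at hcoeff
    have hdvd : (p : ℤ) ∣ 1 := ⟨-f.coeff p, by linear_combination hcoeff⟩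
    exact hp.one_lt.ne' (Nat.dvd_one.mp (by exact_mod_cast hdvd))
end

section
/- Consider the group ℤ and its inhomogeneous cochain complex with trivial coefficients ℤ, so that an n-cochain is a function ℤ^n → ℤ and the coboundary is the standard inhomogeneous one. For every i ≥ 2, if c : ℤ^i → ℤ is a numerical function satisfying the cocycle condition d c = 0, then there is a numerical function b : ℤ^{i−1} → ℤ with d b = c. In other words, the numerical cochains compute the cohomology H^*(ℤ, ℤ), which vanishes in degrees ≥ 2. -/
/-- The standard inhomogeneous coboundary on cochains of the additive group `ℤ` with
trivial coefficients `ℤ`: `d f (g_1,…,g_{n+1}) = f(g_2,…,g_{n+1})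
+ Σ_{i=1}^{n} (−1)^i f(g_1,…,g_i + g_{i+1},…,g_{n+1}) + (−1)^{n+1} f(g_1,…,g_n)`
(expressed with 0-indexing, the last two groups of terms collected via
`Fin.contractNth`). -/
def cobZ {n : ℕ} (f : (Fin n → ℤ) → ℤ) : (Fin (n + 1) → ℤ) → ℤ :=
  fun g => f (fun i => g i.succ) +
    ∑ j : Fin (n + 1), (-1 : ℤ) ^ ((j : ℕ) + 1) * f (Fin.contractNth j (· + ·) g)

open Fin in
lemma cast_snoc {m : ℕ} (a : Fin m → ℤ) (x : ℤ) :
    (fun i => ((snoc a x : Fin (m + 1) → ℤ) i : ℚ)) =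
      (snoc (fun i => (a i : ℚ)) (x : ℚ) : Fin (m + 1) → ℚ) :=
  comp_snoc (fun z : ℤ => (z : ℚ)) a x

open Fin MvPolynomial in
lemma eval_aeval_snoc {m : ℕ} (z : ℚ) (v : Fin m → ℚ) (P : MvPolynomial (Fin (m + 1)) ℚ) :
    eval v (aeval (snoc X (C z) : Fin (m + 1) → MvPolynomial (Fin m) ℚ) P) =
      eval (snoc v z : Fin (m + 1) → ℚ) P := by
  rw [← aeval_eq_eval, ← AlgHom.comp_apply, comp_aeval, ← aeval_eq_eval]
  congr 2
  funext i
  refine lastCases ?_ (fun i => ?_) i <;> simp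

open Fin in
lemma IsNumerical.comp_snoc {m : ℕ} {f : (Fin (m + 1) → ℤ) → ℤ} (hf : IsNumerical f) (z : ℤ) :
    IsNumerical fun g : Fin m → ℤ => f (snoc g z) := by
  obtain ⟨P, hP⟩ := hf
  refine ⟨MvPolynomial.aeval
    (snoc MvPolynomial.X (MvPolynomial.C (z : ℚ)) : Fin (m + 1) → MvPolynomial (Fin m) ℚ) P,
    fun a => ?_⟩
  rw [eval_aeval_snoc, hP, cast_snoc]

lemma IsNumerical.const_mul {m : ℕ} {f : (Fin m → ℤ) → ℤ} (hf : IsNumerical f) (z : ℤ) :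
    IsNumerical fun g => z * f g := by
  obtain ⟨P, hP⟩ := hf
  exact ⟨MvPolynomial.C (z : ℚ) * P, fun a => by simp [hP]⟩

lemma Polynomial.exists_eval_add_one_sub_eval_eq_pow (n : ℕ) :
    ∃ q : Polynomial ℚ, ∀ x, q.eval (x + 1) - q.eval x = x ^ n := by
  refine ⟨Polynomial.C ((n + 1 : ℚ)⁻¹) * Polynomial.bernoulli (n + 1), fun x => ?_⟩
  have hn : (n + 1 : ℚ) ≠ 0 := by positivity
  simp only [Polynomial.eval_mul, Polynomial.eval_C, add_comm x 1,
    Polynomial.bernoulli_eval_one_add, add_tsub_cancel_right]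
  push_cast
  field_simp
  ring

open Fin MvPolynomial in
/-- Every rational polynomial has an indefinite sum with respect to its last variable. -/
lemma MvPolynomial.exists_indefinite_sum {m : ℕ} (P : MvPolynomial (Fin (m + 1)) ℚ) :
    ∃ Q : MvPolynomial (Fin (m + 1)) ℚ, ∀ (a : Fin m → ℚ) (x : ℚ),
      eval (snoc a (x + 1) : Fin (m + 1) → ℚ) Q - eval (snoc a x : Fin (m + 1) → ℚ) Q =
        eval (snoc a x : Fin (m + 1) → ℚ) P := by
  induction P using MvPolynomial.induction_on' with
  | monomial u r =>
    obtain ⟨q, hq⟩ := Polynomial.exists_eval_add_one_sub_eval_eq_pow (u (last m))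
    have hq' (v : Fin (m + 1) → ℚ) :
        eval v (Polynomial.aeval (X (last m) : MvPolynomial (Fin (m + 1)) ℚ) q) =
          q.eval (v (last m)) := by
      rw [← aeval_eq_eval, ← Polynomial.aeval_algHom_apply, aeval_X,
        Polynomial.coe_aeval_eq_eval]
    refine ⟨C r * (∏ i : Fin m, X i.castSucc ^ u i.castSucc) *
      Polynomial.aeval (X (last m)) q, fun a x => ?_⟩
    simp only [map_mul, hq', eval_C, map_prod, map_pow, eval_X, snoc_castSucc, snoc_last,
      eval_monomial, Finsupp.prod_pow, Fin.prod_univ_castSucc, ← hq]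
    ring
  | add p q hp hq =>
    obtain ⟨P, hP⟩ := hp
    obtain ⟨Q, hQ⟩ := hq
    refine ⟨P + Q, fun a x => ?_⟩
    simp only [map_add, ← hP, ← hQ]
    ring

open Fin in
/-- Every numerical function has a numerical indefinite sum with respect to its last variable,
normalized to vanish when that variable is `1`. -/
lemma IsNumerical.exists_indefinite_sum {m : ℕ} {f : (Fin (m + 1) → ℤ) → ℤ}
    (hf : IsNumerical f) :
    ∃ F : (Fin (m + 1) → ℤ) → ℤ, IsNumerical F ∧ (∀ a : Fin m → ℤ, F (snoc a 1) = 0) ∧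
      ∀ (a : Fin m → ℤ) (x : ℤ), F (snoc a (x + 1)) - F (snoc a x) = f (snoc a x) := by
  obtain ⟨P, hP⟩ := hf
  obtain ⟨Q, hQ⟩ := P.exists_indefinite_sum
  let R : MvPolynomial (Fin (m + 1)) ℚ := Q - MvPolynomial.rename castSucc
    (MvPolynomial.aeval
      (snoc MvPolynomial.X (MvPolynomial.C 1) : Fin (m + 1) → MvPolynomial (Fin m) ℚ) Q)
  have hR (a : Fin m → ℚ) (x : ℚ) : MvPolynomial.eval (snoc a x : Fin (m + 1) → ℚ) R =
      MvPolynomial.eval (snoc a x : Fin (m + 1) → ℚ) Q -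
        MvPolynomial.eval (snoc a 1 : Fin (m + 1) → ℚ) Q := by
    have : (snoc a x : Fin (m + 1) → ℚ) ∘ castSucc = a := by funext i; simp
    rw [map_sub, MvPolynomial.eval_rename, this, eval_aeval_snoc]
  have hR_one (a : Fin m → ℚ) : MvPolynomial.eval (snoc a 1 : Fin (m + 1) → ℚ) R = 0 := by
    rw [hR, sub_self]
  have hR_step (a : Fin m → ℤ) (x : ℤ) :
      MvPolynomial.eval (snoc (fun i => (a i : ℚ)) ((x + 1 : ℤ) : ℚ) : Fin (m + 1) → ℚ) R -
        MvPolynomial.eval (snoc (fun i => (a i : ℚ)) (x : ℚ) : Fin (m + 1) → ℚ) R =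
          f (snoc a x) := by
    rw [hP, cast_snoc, ← hQ, hR, hR]
    push_cast
    ring
  have hR_int (g : Fin (m + 1) → ℤ) :
      ∃ z : ℤ, (z : ℚ) = MvPolynomial.eval (fun i => (g i : ℚ)) R := by
    rw [← snoc_init_self g, cast_snoc]
    generalize init g = a
    generalize g (last m) = x
    induction x using Int.inductionOn' (b := 1) with
    | zero => exact ⟨0, by simp [hR_one]⟩
    | succ x _ ih =>
      obtain ⟨z, hz⟩ := ih
      refine ⟨z + f (snoc a x), ?_⟩
      rw [Int.cast_add, hz, ← hR_step]
      ring
    | pred x _ ih =>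
      obtain ⟨z, hz⟩ := ih
      refine ⟨z - f (snoc a (x - 1)), ?_⟩
      rw [Int.cast_sub, hz, ← hR_step, sub_add_cancel]
      ring
  choose F hF using hR_int
  refine ⟨F, ⟨R, hF⟩, fun a => ?_, fun a x => ?_⟩
  · have := hF (snoc a 1)
    rw [cast_snoc, Int.cast_one, hR_one] at this
    exact_mod_cast this
  · have := hR_step a x
    rw [← cast_snoc, ← cast_snoc, ← hF, ← hF] at this
    exact_mod_cast this

lemma cobZ_sub {n : ℕ} (f f' : (Fin n → ℤ) → ℤ) : cobZ (f - f') = cobZ f - cobZ f' := by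
  funext g
  simp only [cobZ, Pi.sub_apply, mul_sub, Finset.sum_sub_distrib]
  ring

lemma cobZ_cobZ {n : ℕ} (f : (Fin n → ℤ) → ℤ) : cobZ (cobZ f) = 0 :=
  congrArg (fun φ => φ.hom f)
    (groupCohomology.inhomogeneousCochains.d_comp_d (n := n)
      (A := Rep.trivial ℤ (Multiplicative ℤ) ℤ))

open Fin in
/-- If a cochain vanishes when its last argument is `1`, then evaluating its coboundary with last
argument `1` computes, up to sign, the difference operator in the last variable. -/
lemma cobZ_snoc_one {m : ℕ} {f : (Fin (m + 1) → ℤ) → ℤ}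
    (hf : ∀ a : Fin m → ℤ, f (snoc a 1) = 0) (a : Fin m → ℤ) (x : ℤ) :
    cobZ f (snoc (snoc a x : Fin (m + 1) → ℤ) 1) =
      (-1) ^ (m + 1) * (f (snoc a (x + 1)) - f (snoc a x)) := by
  have hf' (g : Fin (m + 1) → ℤ) (hg : g (last m) = 1) : f g = 0 := by
    rw [← snoc_init_self g, hg, hf]
  have h_tail : f (fun i => (snoc (snoc a x : Fin (m + 1) → ℤ) 1 : Fin (m + 2) → ℤ) i.succ) = 0 :=
    hf' _ (by rw [succ_last, snoc_last])
  have h_face (j : Fin m) : f (contractNth j.castSucc.castSucc (· + ·)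
      (snoc (snoc a x : Fin (m + 1) → ℤ) 1 : Fin (m + 2) → ℤ)) = 0 :=
    hf' _ (by
      rw [contractNth_apply_of_gt _ _ _ _ (by simp), succ_last, snoc_last])
  have h_merge : contractNth (last m).castSucc (· + ·)
      (snoc (snoc a x : Fin (m + 1) → ℤ) 1 : Fin (m + 2) → ℤ) =
        (snoc a (x + 1) : Fin (m + 1) → ℤ) := by
    funext i
    refine lastCases ?_ (fun i => ?_) i
    · rw [contractNth_apply_of_eq _ _ _ _ (by simp), succ_last]
      simp only [snoc_castSucc, snoc_last]
    · rw [contractNth_apply_of_lt _ _ _ _ (by simp)]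
      simp only [snoc_castSucc]
  have h_drop : contractNth (last (m + 1)) (· + ·)
      (snoc (snoc a x : Fin (m + 1) → ℤ) 1 : Fin (m + 2) → ℤ) =
        (snoc a x : Fin (m + 1) → ℤ) := by
    funext i
    rw [contractNth_apply_of_lt _ _ _ _ i.isLt, snoc_castSucc]
  simp only [cobZ, Fin.sum_univ_castSucc, h_tail, h_face, h_merge, h_drop, val_last, val_castSucc,
    mul_zero, Finset.sum_const_zero]
  ring

open Fin in
/-- A cocycle of positive degree that vanishes when its last argument is `1` is zero. -/
lemma eq_zero_of_cobZ_eq_zero {m : ℕ} {f : (Fin (m + 1) → ℤ) → ℤ} (hd : cobZ f = 0)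
    (hf : ∀ a : Fin m → ℤ, f (snoc a 1) = 0) : f = 0 := by
  have h_step (a : Fin m → ℤ) (x : ℤ) : f (snoc a (x + 1)) = f (snoc a x) := by
    have h := cobZ_snoc_one hf a x
    rw [hd, Pi.zero_apply, zero_eq_mul] at h
    exact sub_eq_zero.mp (h.resolve_left (by simp))
  funext g
  rw [← snoc_init_self g, Pi.zero_apply]
  generalize init g = a
  generalize g (last m) = x
  induction x using Int.inductionOn' (b := 1) with
  | zero => exact hf a
  | succ x _ ih => rw [h_step, ih]
  | pred x _ ih => rw [← h_step, sub_add_cancel, ih]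

/-- Numerical cochains compute the cohomology `H^*(ℤ, ℤ)` in degrees `≥ 2`, where it
vanishes: for every `i = k + 2 ≥ 2`, every numerical `i`-cocycle `c : ℤ^i → ℤ` is the
coboundary of a numerical `(i−1)`-cochain. -/
theorem numerical_cocycle_is_numerical_coboundary (k : ℕ)
    (c : (Fin (k + 2) → ℤ) → ℤ) (hc : IsNumerical c) (hcoc : cobZ c = 0) :
    ∃ b : (Fin (k + 1) → ℤ) → ℤ, IsNumerical b ∧ cobZ b = c := by
  obtain ⟨F, hF, hF_one, hF_step⟩ := (hc.comp_snoc 1).exists_indefinite_sum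
  let b : (Fin (k + 1) → ℤ) → ℤ := fun g => (-1) ^ (k + 1) * F g
  have hb_one (a : Fin k → ℤ) : b (Fin.snoc a 1) = 0 := by simp [b, hF_one]
  refine ⟨b, hF.const_mul _, sub_eq_zero.mp (eq_zero_of_cobZ_eq_zero ?_ fun g => ?_)⟩
  · rw [cobZ_sub, cobZ_cobZ, hcoc, sub_zero]
  · rw [Pi.sub_apply, sub_eq_zero, ← Fin.snoc_init_self g, cobZ_snoc_one hb_one, ← mul_sub,
      ← mul_assoc, ← mul_pow, hF_step]
    simp
end

section
/- Let p be a prime. Composition with reduction mod p induces a bijection from the set of ring homomorphisms Num_m → ℤ_p onto the set of ring homomorphisms Num_m → ℤ/pℤ, where Num_m is the ring of numerical functions ℤ^m → ℤ. Combined with the evaluation description of ℤ_p-points, every ring homomorphism Num_m → ℤ/pℤ is of the form f ↦ P_f(a) mod p for a unique a ∈ ℤ_p^m, where P_f is the rational polynomial representing f (which takes ℤ_p-values on ℤ_p^m). -/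
open MvPolynomial

lemma numRing_exists_eq_mul {m : ℕ} (n : ℕ) (hn : n ≠ 0) (f : numRing m)
    (h : ∀ b, (n : ℤ) ∣ (f : (Fin m → ℤ) → ℤ) b) : ∃ g : numRing m, f = n * g := by
  choose g hg using h
  obtain ⟨P, hP⟩ := f.2
  refine ⟨⟨g, C (n : ℚ)⁻¹ * P, fun a => ?_⟩, ?_⟩
  · have hn' : (n : ℚ) ≠ 0 := Nat.cast_ne_zero.mpr hn
    rw [map_mul, ← hP, eval_C, hg a]
    push_cast
    field_simp
  · ext b
    simpa using hg b

/-- The coordinate functions are numerical. -/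
def numRingCoord {m : ℕ} (i : Fin m) : numRing m :=
  ⟨fun b => b i, X i, fun b => by simp⟩

section Evaluation

variable {p : ℕ} [Fact p.Prime] {m : ℕ}

/-- The value of a rational polynomial at a point with `p`-adic integer coordinates. -/
noncomputable def padicValue (P : MvPolynomial (Fin m) ℚ) (a : Fin m → ℤ_[p]) : ℚ_[p] :=
  eval (fun i => ((a i : ℤ_[p]) : ℚ_[p])) (map (algebraMap ℚ ℚ_[p]) P)

lemma continuous_padicValue (P : MvPolynomial (Fin m) ℚ) :
    Continuous (padicValue (p := p) P) := by
  unfold padicValue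
  exact (MvPolynomial.continuous_eval _).comp (by fun_prop)

lemma padicValue_intCast (P : MvPolynomial (Fin m) ℚ) (b : Fin m → ℤ) :
    padicValue (p := p) P (fun i => (b i : ℤ_[p])) =
      ((eval (fun i => (b i : ℚ)) P : ℚ) : ℚ_[p]) := by
  have h := eval₂_comp_left (algebraMap ℚ ℚ_[p]) (RingHom.id ℚ) (fun i => (b i : ℚ)) P
  simp only [padicValue, eval_map, PadicInt.coe_intCast]
  simpa [Function.comp_def, eval₂_id] using h.symm

lemma denseRange_intCast_pi :
    DenseRange (fun (b : Fin m → ℤ) (i : Fin m) => (b i : ℤ_[p])) :=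
  DenseRange.piMap fun _ => PadicInt.denseRange_intCast

lemma padicValue_eq_of_forall_int {P Q : MvPolynomial (Fin m) ℚ}
    (h : ∀ b : Fin m → ℤ, eval (fun i => (b i : ℚ)) P = eval (fun i => (b i : ℚ)) Q) :
    padicValue (p := p) P = padicValue Q :=
  denseRange_intCast_pi.equalizer (continuous_padicValue P) (continuous_padicValue Q) <| by
    ext b
    simp only [Function.comp_apply, padicValue_intCast, h]

lemma norm_padicValue_le_one {P : MvPolynomial (Fin m) ℚ} {f : (Fin m → ℤ) → ℤ}
    (h : ∀ b : Fin m → ℤ, (f b : ℚ) = eval (fun i => (b i : ℚ)) P) (a : Fin m → ℤ_[p]) :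
    ‖padicValue P a‖ ≤ 1 :=
  denseRange_intCast_pi.induction_on (p := fun a => ‖padicValue P a‖ ≤ 1) a
    (isClosed_le (continuous_padicValue P).norm continuous_const) fun b => by
      rw [padicValue_intCast, ← h]
      simpa using Padic.norm_int_le_one (p := p) (f b)

/-- Evaluation of numerical functions at a point of `ℤ_p^m`, through the representing
polynomial. -/
noncomputable def numRingEval (a : Fin m → ℤ_[p]) : numRing m →+* ℤ_[p] where
  toFun f := ⟨padicValue f.2.choose a, norm_padicValue_le_one f.2.choose_spec a⟩
  map_zero' := Subtype.ext <| by
    refine (congrFun (padicValue_eq_of_forall_int (Q := 0) fun b => ?_) a).trans ?_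
    · rw [← (0 : numRing m).2.choose_spec]; simp
    · simp [padicValue]
  map_one' := Subtype.ext <| by
    refine (congrFun (padicValue_eq_of_forall_int (Q := 1) fun b => ?_) a).trans ?_
    · rw [← (1 : numRing m).2.choose_spec]; simp
    · simp [padicValue]
  map_add' f g := Subtype.ext <| by
    refine (congrFun (padicValue_eq_of_forall_int
      (Q := f.2.choose + g.2.choose) fun b => ?_) a).trans ?_
    · rw [← (f + g).2.choose_spec, map_add, ← f.2.choose_spec, ← g.2.choose_spec]; simp
    · simp only [padicValue, map_add]; rfl
  map_mul' f g := Subtype.ext <| by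
    refine (congrFun (padicValue_eq_of_forall_int
      (Q := f.2.choose * g.2.choose) fun b => ?_) a).trans ?_
    · rw [← (f * g).2.choose_spec, map_mul, ← f.2.choose_spec, ← g.2.choose_spec]; simp
    · simp only [padicValue, map_mul]; rfl

lemma coe_numRingEval (a : Fin m → ℤ_[p]) (f : numRing m) {P : MvPolynomial (Fin m) ℚ}
    (h : ∀ b : Fin m → ℤ,
      ((f : (Fin m → ℤ) → ℤ) b : ℚ) = eval (fun i => (b i : ℚ)) P) :
    (numRingEval a f : ℚ_[p]) = padicValue P a :=
  congrFun (padicValue_eq_of_forall_int fun b => by rw [← f.2.choose_spec, h]) a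

lemma continuous_numRingEval (f : numRing m) :
    Continuous fun a : Fin m → ℤ_[p] => numRingEval a f :=
  (continuous_padicValue f.2.choose).subtype_mk _

lemma numRingEval_intCast (b : Fin m → ℤ) (f : numRing m) :
    numRingEval (fun i => (b i : ℤ_[p])) f = ((f : (Fin m → ℤ) → ℤ) b : ℤ_[p]) := by
  obtain ⟨P, hP⟩ := f.2
  apply Subtype.ext
  rw [coe_numRingEval _ f hP, padicValue_intCast, ← hP]
  simp

lemma numRingEval_coord (a : Fin m → ℤ_[p]) (i : Fin m) :
    numRingEval a (numRingCoord i) = a i := by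
  apply Subtype.ext
  rw [coe_numRingEval (P := X i) a _ fun b => by simp [numRingCoord]]
  simp [padicValue]

end Evaluation

lemma isClosed_toZMod_eq_zero (p : ℕ) [Fact p.Prime] :
    IsClosed {z : ℤ_[p] | PadicInt.toZMod z = 0} := by
  have h : {z : ℤ_[p] | PadicInt.toZMod z = 0} = Metric.ball 0 1 := by
    ext z
    rw [Set.mem_ofPred_eq, ← RingHom.mem_ker, PadicInt.ker_toZMod,
      IsLocalRing.mem_maximalIdeal, PadicInt.mem_nonunits, mem_ball_zero_iff]
  rw [h]
  exact IsUltrametricDist.isClosed_ball _ _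

lemma exists_int_forall_dvd_of_mem_ker {p : ℕ} [Fact p.Prime] {m : ℕ}
    (ψ : numRing m →+* ZMod p) (s : Finset (RingHom.ker ψ)) :
    ∃ b : Fin m → ℤ, ∀ f ∈ s, (p : ℤ) ∣ ((f : numRing m) : (Fin m → ℤ) → ℤ) b := by
  have hp : p.Prime := Fact.out
  by_contra! hcon
  set G : numRing m := ∏ f ∈ s, (1 - (f : numRing m) ^ (p - 1)) with hG
  have hψG : ψ G = 1 := by
    rw [hG, map_prod]
    refine Finset.prod_eq_one fun f _ => ?_
    rw [map_sub, map_one, map_pow, RingHom.mem_ker.mp f.2,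
      zero_pow (Nat.sub_ne_zero_of_lt hp.one_lt), sub_zero]
  obtain ⟨g, hg⟩ := numRing_exists_eq_mul p hp.ne_zero G fun b => by
    obtain ⟨f, hfs, hf⟩ := hcon b
    have hGb : (G : (Fin m → ℤ) → ℤ) b =
        ∏ f ∈ s, (1 - ((f : numRing m) : (Fin m → ℤ) → ℤ) b ^ (p - 1)) := by
      simp [hG, Finset.prod_apply]
    rw [hGb]
    refine Dvd.dvd.trans ?_ (Finset.dvd_prod_of_mem _ hfs)
    rw [← ZMod.intCast_zmod_eq_zero_iff_dvd] at hf
    rw [← ZMod.intCast_zmod_eq_zero_iff_dvd]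
    push_cast
    rw [ZMod.pow_card_sub_one_eq_one hf, sub_self]
  rw [hg, map_mul, map_natCast, CharP.cast_eq_zero, zero_mul] at hψG
  exact zero_ne_one hψG

lemma exists_toZMod_comp_numRingEval_eq {p : ℕ} [Fact p.Prime] {m : ℕ}
    (ψ : numRing m →+* ZMod p) :
    ∃ a : Fin m → ℤ_[p], PadicInt.toZMod.comp (numRingEval a) = ψ := by
  let Z (f : RingHom.ker ψ) : Set (Fin m → ℤ_[p]) :=
    (fun a => numRingEval a (f : numRing m)) ⁻¹' {z | PadicInt.toZMod z = 0}
  have hZ (f : RingHom.ker ψ) : IsClosed (Z f) :=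
    (isClosed_toZMod_eq_zero p).preimage (continuous_numRingEval (f : numRing m))
  have hfin (s : Finset (RingHom.ker ψ)) : (⋂ f ∈ s, Z f).Nonempty := by
    obtain ⟨b, hb⟩ := exists_int_forall_dvd_of_mem_ker ψ s
    refine ⟨fun i => (b i : ℤ_[p]), Set.mem_iInter₂.mpr fun f hf => ?_⟩
    rw [Set.mem_preimage, Set.mem_ofPred_eq, numRingEval_intCast, map_intCast,
      ZMod.intCast_zmod_eq_zero_iff_dvd]
    exact hb f hf
  obtain ⟨a, ha⟩ := CompactSpace.iInter_nonempty hZ hfin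
  refine ⟨a, RingHom.ext fun f => ?_⟩
  have hmem : f - ((ψ f).val : numRing m) ∈ RingHom.ker ψ := by
    simp [RingHom.mem_ker]
  have h : PadicInt.toZMod (numRingEval a (f - ((ψ f).val : numRing m))) = 0 :=
    Set.mem_iInter.mp ha ⟨_, hmem⟩
  rwa [map_sub, map_sub, map_natCast, map_natCast, ZMod.natCast_zmod_val, sub_eq_zero] at h

lemma toZMod_comp_injective (p : ℕ) [Fact p.Prime] (m : ℕ) :
    Function.Injective
      (fun χ : numRing m →+* ℤ_[p] => (PadicInt.toZMod (p := p)).comp χ) := by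
  intro χ₁ χ₂ h
  have hp : p.Prime := Fact.out
  have key : ∀ (n : ℕ) (f : numRing m), (p : ℤ_[p]) ^ (n + 1) ∣ χ₁ f - χ₂ f := by
    intro n
    induction n with
    | zero =>
      intro f
      have hf : PadicInt.toZMod (χ₁ f) = PadicInt.toZMod (χ₂ f) := RingHom.congr_fun h f
      rw [zero_add, pow_one, ← Ideal.mem_span_singleton, ← PadicInt.maximalIdeal_eq_span_p,
        ← PadicInt.ker_toZMod, RingHom.mem_ker, map_sub, hf, sub_self]
    | succ n ih =>
      intro f
      obtain ⟨g, hg⟩ := numRing_exists_eq_mul p hp.ne_zero (f ^ p - f) fun b => by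
        rw [← ZMod.intCast_zmod_eq_zero_iff_dvd]
        simp
      have hf : f = f ^ p - p * g := by rw [← hg]; ring
      have hpow : (p : ℤ_[p]) ^ (n + 2) ∣ χ₁ f ^ p - χ₂ f ^ p := by
        have h₁ : (p : ℤ_[p]) ∣ χ₁ f - χ₂ f := (dvd_pow_self _ n.succ_ne_zero).trans (ih f)
        rw [← geom_sum₂_mul, pow_succ']
        refine mul_dvd_mul ?_ (ih f)
        rw [dvd_geom_sum₂_iff_of_dvd_sub h₁]
        exact dvd_mul_right _ _
      have hlin : (p : ℤ_[p]) ^ (n + 2) ∣ p * (χ₁ g - χ₂ g) := by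
        rw [pow_succ']
        exact mul_dvd_mul_left _ (ih g)
      have hsub : χ₁ f - χ₂ f = (χ₁ f ^ p - χ₂ f ^ p) - p * (χ₁ g - χ₂ g) := by
        conv_lhs => rw [hf]
        simp only [map_sub, map_pow, map_mul, map_natCast]
        ring
      rw [hsub]
      exact dvd_sub hpow hlin
  refine RingHom.ext fun f => sub_eq_zero.mp ?_
  by_contra hne
  obtain ⟨n, hn⟩ := FiniteMultiplicity.of_prime_left PadicInt.prime_p hne
  exact hn (key n f)

/-- Composition with the reduction `ℤ_p → ℤ/pℤ` is a bijection from the set of ring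
homomorphisms `Num_m → ℤ_p` onto the set of ring homomorphisms `Num_m → ℤ/pℤ`.
Moreover, every ring homomorphism `ψ : Num_m → ℤ/pℤ` is of the form
`f ↦ P_f(a) mod p` for a unique point `a ∈ ℤ_p^m`, where `P_f` is the rational
polynomial representing the numerical function `f` (it takes `ℤ_p`-values on `ℤ_p^m`). -/
theorem numRing_homs_to_zmod (p : ℕ) [Fact p.Prime] (m : ℕ) :
    Function.Bijective
      (fun χ : numRing m →+* ℤ_[p] => (PadicInt.toZMod (p := p)).comp χ) ∧
    (∀ ψ : numRing m →+* ZMod p,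
      ∃! a : Fin m → ℤ_[p],
        ∀ (f : numRing m) (P : MvPolynomial (Fin m) ℚ),
          (∀ b : Fin m → ℤ,
            ((f : (Fin m → ℤ) → ℤ) b : ℚ) = MvPolynomial.eval (fun i => (b i : ℚ)) P) →
          ∀ z : ℤ_[p],
            (z : ℚ_[p]) =
              MvPolynomial.eval (fun i => ((a i : ℤ_[p]) : ℚ_[p]))
                (MvPolynomial.map (algebraMap ℚ ℚ_[p]) P) →
          ψ f = PadicInt.toZMod z) := by
  refine ⟨⟨toZMod_comp_injective p m, fun ψ => ?_⟩, fun ψ => ?_⟩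
  · obtain ⟨a, ha⟩ := exists_toZMod_comp_numRingEval_eq ψ
    exact ⟨numRingEval a, ha⟩
  · obtain ⟨a, rfl⟩ := exists_toZMod_comp_numRingEval_eq ψ
    refine ⟨a, fun f P hP z hz => ?_, fun a' ha' => ?_⟩
    · have hza : numRingEval a f = z :=
        Subtype.ext ((coe_numRingEval a f hP).trans hz.symm)
      rw [RingHom.comp_apply, hza]
    · have heq : numRingEval a = numRingEval a' :=
        toZMod_comp_injective p m <| RingHom.ext fun f =>
          ha' f _ f.2.choose_spec _ (coe_numRingEval a' f f.2.choose_spec)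
      funext i
      rw [← numRingEval_coord a i, heq, numRingEval_coord]
end

section
/- Let n ≥ 1 and k ≥ 1, and let A be an n×n matrix over ℚ that is unipotent upper triangular, i.e., A_{ij} = 0 for i > j and A_{ii} = 1 for all i. Then there exists a unique unipotent upper triangular n×n matrix B over ℚ with B^k = A. In particular, the group of unipotent upper triangular rational matrices is uniquely divisible. -/
/-- In a commutative `ℚ`-algebra every unipotent element has a unique unipotent `k`-th root. -/
theorem existsUnique_isNilpotent_sub_one_and_pow_eq {S : Type*} [CommRing S] [Algebra ℚ S]
    {k : ℕ} (hk : k ≠ 0) {a : S} (ha : IsNilpotent (a - 1)) :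
    ∃! b : S, IsNilpotent (b - 1) ∧ b ^ k = a := by
  have hunit : IsUnit (k : S) := by
    simpa using (IsUnit.mk0 (k : ℚ) (Nat.cast_ne_zero.2 hk)).map (algebraMap ℚ S)
  have h := Polynomial.existsUnique_nilpotent_sub_and_aeval_eq_zero (x := (1 : S))
    (P := (Polynomial.X ^ k - Polynomial.C a : Polynomial S))
    (by simpa [isNilpotent_neg_iff] using ha.neg)
    (by simpa [Polynomial.derivative_X_pow] using hunit)
  simpa [← isNilpotent_neg_iff (x := (1 : S) - _), sub_eq_zero] using h

/-- In a `ℚ`-algebra, every unipotent element `a` has a unipotent `k`-th root in the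
subalgebra generated by `a`. -/
theorem exists_mem_adjoin_isNilpotent_sub_one_and_pow_eq {R : Type*} [Ring R] [Algebra ℚ R]
    {k : ℕ} (hk : k ≠ 0) {a : R} (ha : IsNilpotent (a - 1)) :
    ∃ b ∈ Algebra.adjoin ℚ {a}, IsNilpotent (b - 1) ∧ b ^ k = a := by
  let a' : Algebra.adjoin ℚ {a} := ⟨a, Algebra.self_mem_adjoin_singleton ℚ a⟩
  have ha' : IsNilpotent (a' - 1) :=
    (IsNilpotent.map_iff (f := (Algebra.adjoin ℚ {a}).val) Subtype.val_injective).1 (by simpa [a'])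
  obtain ⟨b, ⟨hb, hbk⟩, -⟩ := existsUnique_isNilpotent_sub_one_and_pow_eq hk ha'
  exact ⟨b, b.2, by simpa using hb.map (Algebra.adjoin ℚ {a}).val, congrArg Subtype.val hbk⟩

/-- In a `ℚ`-algebra, if a unipotent element `b` is a polynomial in a unipotent element `c`
and both have the same `k`-th power, then they agree. -/
theorem eq_of_mem_adjoin_of_pow_eq {R : Type*} [Ring R] [Algebra ℚ R]
    {k : ℕ} (hk : k ≠ 0) {b c : R} (hb : IsNilpotent (b - 1)) (hc : IsNilpotent (c - 1))
    (hbc : b ∈ Algebra.adjoin ℚ {c}) (h : b ^ k = c ^ k) : b = c := by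
  let b' : Algebra.adjoin ℚ {c} := ⟨b, hbc⟩
  let c' : Algebra.adjoin ℚ {c} := ⟨c, Algebra.self_mem_adjoin_singleton ℚ c⟩
  have hinj : Function.Injective (Algebra.adjoin ℚ {c}).val := Subtype.val_injective
  have hb' : IsNilpotent (b' - 1) := (IsNilpotent.map_iff hinj).1 (by simpa [b'])
  have hc' : IsNilpotent (c' - 1) := (IsNilpotent.map_iff hinj).1 (by simpa [c'])
  have hpow : b' ^ k = c' ^ k := Subtype.ext h
  have hck : IsNilpotent (c' ^ k - 1) := by
    obtain ⟨d, hd⟩ := sub_one_dvd_pow_sub_one c' k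
    rw [hd]
    exact (Commute.all _ _).isNilpotent_mul_right hc'
  exact congrArg Subtype.val ((existsUnique_isNilpotent_sub_one_and_pow_eq hk hck).unique
    ⟨hb', hpow⟩ ⟨hc', rfl⟩)

namespace Matrix

theorem BlockTriangular.mul_apply_self {m R : Type*} [Fintype m] [LinearOrder m] [Semiring R]
    {M N : Matrix m m R} (hM : M.BlockTriangular id) (hN : N.BlockTriangular id) (i : m) :
    (M * N) i i = M i i * N i i := by
  rw [mul_apply, Finset.sum_eq_single i _ (by simp)]
  intro j _ hj
  rcases lt_or_gt_of_ne hj with h | h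
  · rw [hM h, zero_mul]
  · rw [hN h, mul_zero]

theorem BlockTriangular.pow_apply_self {m R : Type*} [Fintype m] [LinearOrder m] [Semiring R]
    {M : Matrix m m R} (hM : M.BlockTriangular id) (i : m) (k : ℕ) :
    (M ^ k) i i = M i i ^ k := by
  induction k with
  | zero => simp
  | succ k ih => rw [pow_succ, (hM.pow k).mul_apply_self hM, ih, pow_succ]

theorem BlockTriangular.isNilpotent_iff {m R : Type*} [Fintype m] [LinearOrder m] [CommRing R]
    [IsReduced R] {M : Matrix m m R} (hM : M.BlockTriangular id) :
    IsNilpotent M ↔ ∀ i, M i i = 0 := by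
  refine ⟨fun ⟨k, hk⟩ i ↦ ?_, fun h ↦ ⟨Fintype.card m, ?_⟩⟩
  · refine eq_zero_of_pow_eq_zero (n := k) ?_
    rw [← hM.pow_apply_self, hk, zero_apply]
  · have := aeval_self_charpoly M
    rw [charpoly_of_isUpperTriangular M hM] at this
    simpa [h] using this

theorem BlockTriangular.isNilpotent_sub_one_iff {m R : Type*} [Fintype m] [LinearOrder m]
    [CommRing R] [IsReduced R] {M : Matrix m m R} (hM : M.BlockTriangular id) :
    IsNilpotent (M - 1) ↔ ∀ i, M i i = 1 := by
  simp [(hM.sub blockTriangular_one).isNilpotent_iff, sub_eq_zero]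

end Matrix


/-- Every unipotent upper triangular matrix over `ℚ` has a unique `k`-th root (`k ≥ 1`)
which is again unipotent upper triangular; in particular the group of unipotent upper
triangular rational matrices is uniquely divisible. -/
theorem unipotent_upper_triangular_unique_root (n k : ℕ) (hn : 1 ≤ n) (hk : 1 ≤ k)
    (A : Matrix (Fin n) (Fin n) ℚ)
    (hA_low : ∀ i j : Fin n, j < i → A i j = 0)
    (hA_diag : ∀ i : Fin n, A i i = 1) :
    ∃! B : Matrix (Fin n) (Fin n) ℚ,
      (∀ i j : Fin n, j < i → B i j = 0) ∧ (∀ i : Fin n, B i i = 1) ∧ B ^ k = A := by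
  have hk0 : k ≠ 0 := Nat.one_le_iff_ne_zero.1 hk
  have hA : A.BlockTriangular id := fun i j h ↦ hA_low i j h
  obtain ⟨B, hBA, hB, hBk⟩ :=
    exists_mem_adjoin_isNilpotent_sub_one_and_pow_eq hk0 (hA.isNilpotent_sub_one_iff.2 hA_diag)
  have hBt : B.BlockTriangular id := by
    have hle : Algebra.adjoin ℚ {A} ≤ Matrix.blockTriangularSubalgebra ℚ ℚ id :=
      Algebra.adjoin_le (by simpa using hA)
    exact hle hBA
  refine ⟨B, ⟨fun i j h ↦ hBt h, hBt.isNilpotent_sub_one_iff.1 hB, hBk⟩, ?_⟩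
  rintro C ⟨hC_low, hC_diag, hCk⟩
  have hCt : C.BlockTriangular id := fun i j h ↦ hC_low i j h
  have hle : Algebra.adjoin ℚ {A} ≤ Algebra.adjoin ℚ {C} := by
    refine Algebra.adjoin_le (Set.singleton_subset_iff.2 ?_)
    exact hCk ▸ pow_mem (Algebra.self_mem_adjoin_singleton ℚ C) k
  exact (eq_of_mem_adjoin_of_pow_eq hk0 hB (hCt.isNilpotent_sub_one_iff.2 hC_diag) (hle hBA)
    (hBk.trans hCk.symm)).symm
end
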